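/- Let p ≥ 4 be an even integer and n an integer with n ≡ 2 (mod 4) and 14 ≤ n ≤ 4p. Then the Graovac–Pisanski index of AT(n,p) satisfies Ŵ(AT(n,p)) = (p+1)·(n⁴/48 + (3n³p)/4 + (3n³)/4 + n²p² + 2n²p + (11n²)/12 − np − n). -/

import Mathlib

open SimpleGraph

/-- Base relation for the armchair nanotube `AT(n,p)`: vertices are pairs `(i, j)` with
layer `i ∈ {0, …, p}` and position `j ∈ ℤ/2nℤ`.  `(i,j)` is related to `(i, j+1)`,
and to `(i+1, j-1)` when `j ≡ 2 (mod 4)`, and to `(i+1, j+1)` when `j ≡ 3 (mod 4)`. -/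
def ATRel (n p : ℕ) (u v : Fin (p + 1) × ZMod (2 * n)) : Prop :=
  (u.1 = v.1 ∧ v.2 = u.2 + 1) ∨
    ((u.1 : ℕ) + 1 = (v.1 : ℕ) ∧
      ((u.2.val % 4 = 2 ∧ v.2 = u.2 - 1) ∨ (u.2.val % 4 = 3 ∧ v.2 = u.2 + 1)))

/-- The armchair nanotube `AT(n,p)` as a simple graph. -/
def AT (n p : ℕ) : SimpleGraph (Fin (p + 1) × ZMod (2 * n)) :=
  SimpleGraph.fromRel (ATRel n p)

/-- `Vset n p k i` is the set `V^k_i` of vertices of type `k` in layer `i` of `AT(n,p)`: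
type `0` means `j mod 4 ∈ {0,1}`, type `1` means `j mod 4 ∈ {2,3}`. -/
def Vset (n p : ℕ) (k i : ℕ) : Set (Fin (p + 1) × ZMod (2 * n)) :=
  {v | (v.1 : ℕ) = i ∧ v.2.val % 4 / 2 = k}

/-- The set of vertices of `AT(n,p)` in layer `i` (the vertex set of the induced
cycle `C1` for `i = 0`, and of `C2` for `i = p`). -/
def layer (n p : ℕ) (i : ℕ) : Set (Fin (p + 1) × ZMod (2 * n)) :=
  {v | (v.1 : ℕ) = i}

/-- The Graovac–Pisanski index of a graph `G`:
`Ŵ(G) = (|V(G)| / (2 |Aut(G)|)) * Σ_u Σ_α d(u, α(u))`. -/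
noncomputable def GPindex {V : Type*} (G : SimpleGraph V) : ℚ :=
  ((Nat.card V : ℚ) / (2 * (Nat.card (G ≃g G) : ℚ))) *
    ∑ᶠ u : V, ∑ᶠ α : G ≃g G, (G.dist u (α u) : ℚ)

/-- One edge of the universal cover (position coordinate lifted to the integers). -/
def Stp (i b i' b' : ℤ) : Prop :=
  (i' = i ∧ (b' = b + 1 ∨ b' = b - 1)) ∨
  (i' = i + 1 ∧ ((b % 4 = 2 ∧ b' = b - 1) ∨ (b % 4 = 3 ∧ b' = b + 1))) ∨
  (i' = i - 1 ∧ ((b % 4 = 1 ∧ b' = b + 1) ∨ (b % 4 = 0 ∧ b' = b - 1)))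

/-- Distance from the origin in the universal cover. -/
def DD (a b : ℤ) : ℕ :=
  ((b + 1) / 2).natAbs + (a + (b + 2) / 4).natAbs + (a - b / 4).natAbs

theorem DD_step (i0 i b i' b' : ℤ) (h : Stp i b i' b') :
    DD (i' - i0) b' ≤ DD (i - i0) b + 1 := by
  unfold Stp at h; unfold DD
  omega

set_option maxHeartbeats 1000000 in
theorem DD_desc (a b : ℤ) (h : 0 < DD a b) :
    DD a (b - 1) < DD a b ∨ DD a (b + 1) < DD a b ∨
    (a < 0 ∧ b % 4 = 2 ∧ DD (a + 1) (b - 1) < DD a b) ∨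
    (a < 0 ∧ b % 4 = 3 ∧ DD (a + 1) (b + 1) < DD a b) ∨
    (0 < a ∧ b % 4 = 1 ∧ DD (a - 1) (b + 1) < DD a b) ∨
    (0 < a ∧ b % 4 = 0 ∧ DD (a - 1) (b - 1) < DD a b) := by
  unfold DD at *
  obtain ⟨c, hc⟩ : ∃ c, c = b / 4 := ⟨_, rfl⟩
  have h4 : b % 4 = 0 ∨ b % 4 = 1 ∨ b % 4 = 2 ∨ b % 4 = 3 := by omega
  rcases h4 with h4 | h4 | h4 | h4
  · obtain rfl : b = 4 * c := by omega
    have e1 : (4*c+1)/2 = 2*c := by omega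
    have e2 : (4*c+2)/4 = c := by omega
    have e3 : (4*c)/4 = c := by omega
    have e4 : (4*c-1+1)/2 = 2*c := by omega
    have e5 : (4*c-1+2)/4 = c := by omega
    have e6 : (4*c-1)/4 = c-1 := by omega
    have e7 : (4*c+1+1)/2 = 2*c+1 := by omega
    have e8 : (4*c+1+2)/4 = c := by omega
    have e9 : (4*c+1)/4 = c := by omega
    simp only [e1,e2,e3,e4,e5,e6,e7,e8,e9] at *
    clear e1 e2 e3 e4 e5 e6 e7 e8 e9
    rcases lt_or_ge c 0 with hc0 | hc0
    · right; left; omega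
    · rcases lt_or_ge 0 a with ha | ha
      · right; right; right; right; right; refine ⟨ha, h4, ?_⟩; omega
      · left; omega
  · obtain rfl : b = 4 * c + 1 := by omega
    have e1 : (4*c+1+1)/2 = 2*c+1 := by omega
    have e2 : (4*c+1+2)/4 = c := by omega
    have e3 : (4*c+1)/4 = c := by omega
    have e4 : (4*c+1-1+1)/2 = 2*c := by omega
    have e5 : (4*c+1-1+2)/4 = c := by omega
    have e6 : (4*c+1-1)/4 = c := by omega
    have e7 : (4*c+1+1+1)/2 = 2*c+1 := by omega
    have e8 : (4*c+1+1+2)/4 = c+1 := by omega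
    have e9 : (4*c+1+1)/4 = c := by omega
    simp only [e1,e2,e3,e4,e5,e6,e7,e8,e9] at *
    clear e1 e2 e3 e4 e5 e6 e7 e8 e9
    rcases lt_or_ge c 0 with hc0 | hc0
    · rcases lt_or_ge 0 a with ha | ha
      · right; right; right; right; left; refine ⟨ha, h4, ?_⟩; omega
      · right; left; omega
    · left; omega
  · obtain rfl : b = 4 * c + 2 := by omega
    have e1 : (4*c+2+1)/2 = 2*c+1 := by omega
    have e2 : (4*c+2+2)/4 = c+1 := by omega
    have e3 : (4*c+2)/4 = c := by omega
    have e4 : (4*c+2-1+1)/2 = 2*c+1 := by omega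
    have e5 : (4*c+2-1+2)/4 = c := by omega
    have e6 : (4*c+2-1)/4 = c := by omega
    have e7 : (4*c+2+1+1)/2 = 2*c+2 := by omega
    have e8 : (4*c+2+1+2)/4 = c+1 := by omega
    have e9 : (4*c+2+1)/4 = c := by omega
    simp only [e1,e2,e3,e4,e5,e6,e7,e8,e9] at *
    clear e1 e2 e3 e4 e5 e6 e7 e8 e9
    rcases lt_or_ge c 0 with hc0 | hc0
    · right; left; omega
    · rcases lt_or_ge a 0 with ha | ha
      · right; right; left; refine ⟨ha, h4, ?_⟩; omega
      · left; omega
  · obtain rfl : b = 4 * c + 3 := by omega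
    have e1 : (4*c+3+1)/2 = 2*c+2 := by omega
    have e2 : (4*c+3+2)/4 = c+1 := by omega
    have e3 : (4*c+3)/4 = c := by omega
    have e4 : (4*c+3-1+1)/2 = 2*c+1 := by omega
    have e5 : (4*c+3-1+2)/4 = c+1 := by omega
    have e6 : (4*c+3-1)/4 = c := by omega
    have e7 : (4*c+3+1+1)/2 = 2*c+2 := by omega
    have e8 : (4*c+3+1+2)/4 = c+1 := by omega
    have e9 : (4*c+3+1)/4 = c+1 := by omega
    simp only [e1,e2,e3,e4,e5,e6,e7,e8,e9] at *
    clear e1 e2 e3 e4 e5 e6 e7 e8 e9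
    rcases lt_or_ge c 0 with hc0 | hc0
    · rcases lt_or_ge a 0 with ha | ha
      · right; right; right; left; refine ⟨ha, h4, ?_⟩; omega
      · right; left; omega
    · left; omega

theorem DD_zero (a b : ℤ) (h : DD a b = 0) : a = 0 ∧ b = 0 := by
  unfold DD at h; omega

theorem val_mod4 (k : ℕ) (b : ℤ) :
    (((b : ZMod (2 * (4 * k + 2))).val : ℕ) : ℤ) % 4 = b % 4 := by
  rw [ZMod.val_intCast]
  apply Int.emod_emod_of_dvd
  exact ⟨2 * k + 1, by push_cast; ring⟩

theorem lift_ex (k : ℕ) (x : ZMod (2 * (4 * k + 2))) : ∃ b : ℤ, x = (b : ZMod (2 * (4 * k + 2))) :=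
  ⟨_, (ZMod.intCast_zmod_cast x).symm⟩

theorem int_eq_iff (k : ℕ) (b c : ℤ) :
    (b : ZMod (2 * (4 * k + 2))) = (c : ZMod (2 * (4 * k + 2))) ↔ ((8 * k + 4 : ℤ)) ∣ c - b := by
  rw [ZMod.intCast_eq_intCast_iff_dvd_sub]
  have : (((2 * (4 * k + 2) : ℕ)) : ℤ) = 8 * k + 4 := by push_cast; ring
  rw [this]

/-- small differences are nonzero -/
theorem int_ne (k : ℕ) (b c : ℤ) (h : b ≠ c) (h1 : c - b < 4) (h2 : b - c < 4) :
    (b : ZMod (2 * (4 * k + 2))) ≠ (c : ZMod (2 * (4 * k + 2))) := by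
  rw [Ne, int_eq_iff]
  rintro ⟨q, hq⟩
  rcases lt_trichotomy q 0 with hq0 | hq0 | hq0
  · nlinarith
  · subst hq0; omega
  · nlinarith

theorem adj_of_stp (k p : ℕ) (i i' : Fin (p + 1)) (b b' : ℤ)
    (h : Stp (i : ℕ) b (i' : ℕ) b') :
    (AT (4 * k + 2) p).Adj (i, (b : ZMod (2 * (4 * k + 2)))) (i', (b' : ZMod (2 * (4 * k + 2)))) := by
  have hv := val_mod4 k b
  have hv' := val_mod4 k b'
  unfold AT
  rw [SimpleGraph.fromRel_adj]
  constructor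
  · intro he
    have h2 : (b : ZMod (2 * (4 * k + 2))) = b' := congrArg Prod.snd he
    refine int_ne k b b' ?_ ?_ ?_ h2 <;> unfold Stp at h <;> omega
  · unfold ATRel
    rcases h with ⟨h1, h | h⟩ | ⟨h1, ⟨h2, h⟩ | ⟨h2, h⟩⟩ | ⟨h1, ⟨h2, h⟩ | ⟨h2, h⟩⟩
    · left; left; exact ⟨Fin.ext (by simp; omega), by simp [h]⟩
    · right; left; exact ⟨Fin.ext (by simp; omega), by simp [h]⟩
    · left; right; exact ⟨by simp; omega, Or.inl ⟨by simp; omega, by simp [h]⟩⟩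
    · left; right; exact ⟨by simp; omega, Or.inr ⟨by simp; omega, by simp [h]⟩⟩
    · right; right; exact ⟨by simp; omega, Or.inl ⟨by simp; omega, by simp [h]⟩⟩
    · right; right; exact ⟨by simp; omega, Or.inr ⟨by simp; omega, by simp [h]⟩⟩

theorem stp_of_adj (k p : ℕ) (i i' : Fin (p + 1)) (b : ℤ) (w : ZMod (2 * (4 * k + 2)))
    (h : (AT (4 * k + 2) p).Adj (i, (b : ZMod (2 * (4 * k + 2)))) (i', w)) :
    ∃ b' : ℤ, w = (b' : ZMod (2 * (4 * k + 2))) ∧ Stp (i : ℕ) b (i' : ℕ) b' := by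
  have hv := val_mod4 k b
  unfold AT at h
  rw [SimpleGraph.fromRel_adj] at h
  obtain ⟨-, h⟩ := h
  unfold ATRel at h
  simp only at h
  rcases h with (⟨h1, h2⟩ | ⟨h1, ⟨h3, h2⟩ | ⟨h3, h2⟩⟩) | (⟨h1, h2⟩ | ⟨h1, ⟨h3, h2⟩ | ⟨h3, h2⟩⟩)
  · exact ⟨b + 1, by rw [h2]; push_cast; rfl, by unfold Stp; subst h1; omega⟩
  · exact ⟨b - 1, by rw [h2]; push_cast; rfl, by unfold Stp; omega⟩
  · exact ⟨b + 1, by rw [h2]; push_cast; rfl, by unfold Stp; omega⟩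
  · have hw : w = ((b - 1 : ℤ) : ZMod (2 * (4 * k + 2))) := by rw [Int.cast_sub, h2]; simp
    exact ⟨b - 1, hw, by unfold Stp; subst h1; omega⟩
  · have hw : w = ((b + 1 : ℤ) : ZMod (2 * (4 * k + 2))) := by rw [Int.cast_add, h2]; simp
    have hv' := val_mod4 k (b+1)
    rw [← hw] at hv'
    exact ⟨b + 1, hw, by unfold Stp; omega⟩
  · have hw : w = ((b - 1 : ℤ) : ZMod (2 * (4 * k + 2))) := by rw [Int.cast_sub, h2]; simp
    have hv' := val_mod4 k (b-1)
    rw [← hw] at hv'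
    exact ⟨b - 1, hw, by unfold Stp; omega⟩

theorem exists_walk (k p : ℕ) (i : Fin (p + 1)) (m : ℕ) : ∀ (i' : Fin (p + 1)) (b : ℤ),
    DD ((i' : ℕ) - (i : ℕ)) b ≤ m →
    ∃ w : (AT (4 * k + 2) p).Walk (i', (b : ZMod (2 * (4 * k + 2)))) (i, 0), w.length ≤ m := by
  induction m with
  | zero =>
    intro i' b h
    obtain ⟨h1, h2⟩ := DD_zero _ _ (Nat.le_zero.mp h)
    have : i' = i := Fin.ext (by omega)
    subst this; subst h2
    rw [Int.cast_zero]
    exact ⟨SimpleGraph.Walk.nil, le_refl _⟩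
  | succ m ih =>
    intro i' b h
    by_cases h0 : DD ((i' : ℕ) - (i : ℕ)) b = 0
    · obtain ⟨w, hw⟩ := ih i' b (by omega)
      exact ⟨w, by omega⟩
    have key : ∀ (i'' : Fin (p + 1)) (b' : ℤ), Stp (i' : ℕ) b (i'' : ℕ) b' →
        DD ((i'' : ℕ) - (i : ℕ)) b' ≤ m →
        ∃ w : (AT (4 * k + 2) p).Walk (i', (b : ZMod (2 * (4 * k + 2)))) (i, 0),
          w.length ≤ m + 1 := by
      intro i'' b' hs hd
      obtain ⟨w, hw⟩ := ih i'' b' hd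
      exact ⟨SimpleGraph.Walk.cons (adj_of_stp k p i' i'' b b' hs) w, by simpa using hw⟩
    have hi := i.2
    have hi' := i'.2
    rcases DD_desc _ _ (Nat.pos_of_ne_zero h0) with hd | hd | ⟨ha, hb, hd⟩ | ⟨ha, hb, hd⟩ |
        ⟨ha, hb, hd⟩ | ⟨ha, hb, hd⟩
    · exact key i' (b - 1) (by unfold Stp; omega) (by omega)
    · exact key i' (b + 1) (by unfold Stp; omega) (by omega)
    · refine key ⟨i' + 1, by omega⟩ (b - 1) (by unfold Stp; push_cast; omega) ?_
      have e : (((i' : ℕ) + 1 : ℕ) : ℤ) - (i : ℕ) = (i' : ℕ) - (i : ℕ) + 1 := by push_cast; ring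
      simp only [e]; omega
    · refine key ⟨i' + 1, by omega⟩ (b + 1) (by unfold Stp; push_cast; omega) ?_
      have e : (((i' : ℕ) + 1 : ℕ) : ℤ) - (i : ℕ) = (i' : ℕ) - (i : ℕ) + 1 := by push_cast; ring
      simp only [e]; omega
    · refine key ⟨i' - 1, by omega⟩ (b + 1) (Or.inr (Or.inr ⟨by simp only; omega, Or.inl ⟨hb, rfl⟩⟩)) ?_
      have e : (((i' : ℕ) - 1 : ℕ) : ℤ) - (i : ℕ) = (i' : ℕ) - (i : ℕ) - 1 := by omega
      simp only [e]; omega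
    · refine key ⟨i' - 1, by omega⟩ (b - 1) (Or.inr (Or.inr ⟨by simp only; omega, Or.inr ⟨hb, rfl⟩⟩)) ?_
      have e : (((i' : ℕ) - 1 : ℕ) : ℤ) - (i : ℕ) = (i' : ℕ) - (i : ℕ) - 1 := by omega
      simp only [e]; omega

theorem walk_lift (k p : ℕ) (i : Fin (p + 1)) (u v : Fin (p + 1) × ZMod (2 * (4 * k + 2)))
    (w : (AT (4 * k + 2) p).Walk u v) : ∀ b : ℤ, u.2 = (b : ZMod (2 * (4 * k + 2))) →
    ∃ b' : ℤ, v.2 = (b' : ZMod (2 * (4 * k + 2))) ∧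
      DD ((v.1 : ℕ) - (i : ℕ)) b' ≤ DD ((u.1 : ℕ) - (i : ℕ)) b + w.length := by
  induction w with
  | nil => intro b hb; exact ⟨b, hb, by simp⟩
  | @cons u x v h w ih =>
    intro b hb
    obtain ⟨u1, u2⟩ := u
    obtain ⟨x1, x2⟩ := x
    simp only at hb
    subst hb
    obtain ⟨b', hx, hs⟩ := stp_of_adj k p _ _ _ _ h
    obtain ⟨c, hc, hd⟩ := ih b' hx
    refine ⟨c, hc, ?_⟩
    have := DD_step (i : ℕ) _ _ _ _ hs
    rw [SimpleGraph.Walk.length_cons]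
    simp only at hd ⊢
    omega

theorem dist_eq (k p : ℕ) (i i' : Fin (p + 1)) (b : ℤ)
    (h : ∀ M : ℤ, (M = 0 ∨ 2 * k + 1 ≤ M ∨ M ≤ - (2 * k + 1)) →
      DD ((i' : ℕ) - (i : ℕ)) b ≤ DD ((i' : ℕ) - (i : ℕ)) (b + 4 * M)) :
    (AT (4 * k + 2) p).dist (i, 0) (i', (b : ZMod (2 * (4 * k + 2)))) =
      DD ((i' : ℕ) - (i : ℕ)) b := by
  obtain ⟨w, hw⟩ := exists_walk k p i _ i' b le_rfl
  apply le_antisymm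
  · rw [SimpleGraph.dist_comm]
    exact (SimpleGraph.dist_le w).trans hw
  · have hr : (AT (4 * k + 2) p).Reachable (i, 0) (i', (b : ZMod (2 * (4 * k + 2)))) :=
      ⟨w.reverse⟩
    obtain ⟨w', hw'⟩ := hr.exists_walk_length_eq_dist
    obtain ⟨b', hb', hd⟩ := walk_lift k p i _ _ w' 0 (by simp)
    rw [← hw']
    simp only at hb' hd
    rw [int_eq_iff] at hb'
    obtain ⟨q, hq⟩ := hb'
    have h0 : DD ((i : ℕ) - (i : ℕ)) 0 = 0 := by simp [DD]
    rw [h0, zero_add] at hd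
    refine le_trans ?_ hd
    have := h ((2 * k + 1) * q) (by
      rcases lt_trichotomy q 0 with hq0 | hq0 | hq0
      · right; right; nlinarith
      · left; simp [hq0]
      · right; left; nlinarith)
    have e : b' = b + 4 * ((2 * k + 1) * q) := by linarith
    rw [e]; exact this

/-- The map of the tube attached to the integer `t` (rotation, reflection, flips). -/
def phiF (k p : ℕ) (t : ℤ) (u : Fin (p + 1) × ZMod (2 * (4 * k + 2))) :
    Fin (p + 1) × ZMod (2 * (4 * k + 2)) :=
  (if t % 4 < 2 then u.1 else Fin.rev u.1, if t % 2 = 0 then (t : ZMod (2 * (4 * k + 2))) + u.2 else (t : ZMod (2 * (4 * k + 2))) - u.2)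

set_option maxHeartbeats 1000000 in
theorem phiF_adj (k p : ℕ) (t : ℤ) (u v : Fin (p + 1) × ZMod (2 * (4 * k + 2)))
    (h : (AT (4 * k + 2) p).Adj u v) :
    (AT (4 * k + 2) p).Adj (phiF k p t u) (phiF k p t v) := by
  obtain ⟨i, x⟩ := u
  obtain ⟨i', x'⟩ := v
  obtain ⟨b, rfl⟩ := lift_ex k x
  obtain ⟨b', rfl, hs⟩ := stp_of_adj k p _ _ _ _ h
  have hi := i.2
  have hi' := i'.2
  have r1 : ((Fin.rev i : Fin (p + 1)) : ℕ) = p - i := by rw [Fin.val_rev]; omega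
  have r2 : ((Fin.rev i' : Fin (p + 1)) : ℕ) = p - i' := by rw [Fin.val_rev]; omega
  unfold phiF
  have h4 : t % 4 = 0 ∨ t % 4 = 1 ∨ t % 4 = 2 ∨ t % 4 = 3 := by omega
  unfold Stp at hs
  rcases h4 with h4 | h4 | h4 | h4
  · have a1 : t % 4 < 2 := by omega
    have a2 : t % 2 = 0 := by omega
    simp only [a1, a2, if_true, ← Int.cast_add]
    apply adj_of_stp
    unfold Stp
    rcases hs with ⟨h1, h | h⟩ | ⟨h1, ⟨h2, h⟩ | ⟨h2, h⟩⟩ | ⟨h1, ⟨h2, h⟩ | ⟨h2, h⟩⟩ <;> omega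
  · have a1 : t % 4 < 2 := by omega
    have a2 : ¬ t % 2 = 0 := by omega
    simp only [a1, a2, if_true, if_false, ← Int.cast_sub]
    apply adj_of_stp
    unfold Stp
    rcases hs with ⟨h1, h | h⟩ | ⟨h1, ⟨h2, h⟩ | ⟨h2, h⟩⟩ | ⟨h1, ⟨h2, h⟩ | ⟨h2, h⟩⟩ <;> omega
  · have a1 : ¬ t % 4 < 2 := by omega
    have a2 : t % 2 = 0 := by omega
    simp only [a1, a2, if_true, if_false, ← Int.cast_add]
    apply adj_of_stp
    unfold Stp
    rw [r1, r2]
    rcases hs with ⟨h1, h | h⟩ | ⟨h1, ⟨h2, h⟩ | ⟨h2, h⟩⟩ | ⟨h1, ⟨h2, h⟩ | ⟨h2, h⟩⟩ <;> omega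
  · have a1 : ¬ t % 4 < 2 := by omega
    have a2 : ¬ t % 2 = 0 := by omega
    simp only [a1, a2, if_false, ← Int.cast_sub]
    apply adj_of_stp
    unfold Stp
    rw [r1, r2]
    rcases hs with ⟨h1, h | h⟩ | ⟨h1, ⟨h2, h⟩ | ⟨h2, h⟩⟩ | ⟨h1, ⟨h2, h⟩ | ⟨h2, h⟩⟩ <;> omega

theorem phiF_inv (k p : ℕ) (t : ℤ) (u : Fin (p + 1) × ZMod (2 * (4 * k + 2))) :
    phiF k p (if t % 2 = 0 then -t else t) (phiF k p t u) = u := by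
  unfold phiF
  by_cases a2 : t % 2 = 0
  · have a3 : (-t) % 2 = 0 := by omega
    by_cases a1 : t % 4 < 2
    · have a4 : (-t) % 4 < 2 := by omega
      simp [a1, a2, a3, a4]
    · have a4 : ¬ (-t) % 4 < 2 := by omega
      simp [a1, a2, a3, a4]
  · by_cases a1 : t % 4 < 2 <;> simp [a1, a2]

theorem inv_inv_t (t : ℤ) : (if (if t % 2 = 0 then -t else t) % 2 = 0 then
    -(if t % 2 = 0 then -t else t) else (if t % 2 = 0 then -t else t)) = t := by
  by_cases a2 : t % 2 = 0
  · have a3 : (-t) % 2 = 0 := by omega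
    simp [a2, a3]
  · simp [a2]

/-- The automorphism of the tube attached to the integer `t`. -/
def phi (k p : ℕ) (t : ℤ) : AT (4 * k + 2) p ≃g AT (4 * k + 2) p where
  toFun := phiF k p t
  invFun := phiF k p (if t % 2 = 0 then -t else t)
  left_inv := phiF_inv k p t
  right_inv := by
    intro u
    have := phiF_inv k p (if t % 2 = 0 then -t else t) u
    rw [inv_inv_t] at this
    exact this
  map_rel_iff' := by
    intro u v
    constructor
    · intro h
      have := phiF_adj k p (if t % 2 = 0 then -t else t) _ _ h
      simp only [Equiv.coe_fn_mk, phiF_inv] at this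
      exact this
    · intro h
      exact phiF_adj k p t _ _ h

theorem phi_apply (k p : ℕ) (t : ℤ) (u) : phi k p t u = phiF k p t u := rfl

/-- at most two neighbours -/
def Bd (k p : ℕ) (u : Fin (p + 1) × ZMod (2 * (4 * k + 2))) : Prop :=
  ∃ x y, ∀ w, (AT (4 * k + 2) p).Adj u w → w = x ∨ w = y

theorem Bd_iso (k p : ℕ) (α : AT (4 * k + 2) p ≃g AT (4 * k + 2) p) (u) (h : Bd k p u) :
    Bd k p (α u) := by
  obtain ⟨x, y, h⟩ := h
  refine ⟨α x, α y, fun w hw => ?_⟩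
  have h1 : (AT (4 * k + 2) p).Adj u (α.symm w) := by
    rw [← α.map_adj_iff]; simpa using hw
  rcases h _ h1 with h2 | h2
  · left; rw [← h2]; simp
  · right; rw [← h2]; simp

theorem Bd_iff (k p : ℕ) (hp : 4 ≤ p) (i : Fin (p + 1)) (b : ℤ) :
    Bd k p (i, (b : ZMod (2 * (4 * k + 2)))) ↔
      (((i : ℕ) = 0 ∧ b % 4 < 2) ∨ ((i : ℕ) = p ∧ 2 ≤ b % 4)) := by
  constructor
  · rintro ⟨x, y, h⟩
    by_contra hcon
    have hi := i.2
    have hex : ∃ (i' : Fin (p + 1)) (b' : ℤ), (i' ≠ i) ∧ Stp (i : ℕ) b (i' : ℕ) b' := by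
      have h4 : b % 4 = 0 ∨ b % 4 = 1 ∨ b % 4 = 2 ∨ b % 4 = 3 := by omega
      rcases h4 with h4 | h4 | h4 | h4
      · refine ⟨⟨(i : ℕ) - 1, by omega⟩, b - 1, ?_, Or.inr (Or.inr ⟨by simp only; omega, Or.inr ⟨h4, rfl⟩⟩)⟩
        rw [Ne, Fin.ext_iff]; simp only; omega
      · refine ⟨⟨(i : ℕ) - 1, by omega⟩, b + 1, ?_, Or.inr (Or.inr ⟨by simp only; omega, Or.inl ⟨h4, rfl⟩⟩)⟩
        rw [Ne, Fin.ext_iff]; simp only; omega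
      · refine ⟨⟨(i : ℕ) + 1, by omega⟩, b - 1, ?_, Or.inr (Or.inl ⟨by simp, Or.inl ⟨h4, rfl⟩⟩)⟩
        rw [Ne, Fin.ext_iff]; simp
      · refine ⟨⟨(i : ℕ) + 1, by omega⟩, b + 1, ?_, Or.inr (Or.inl ⟨by simp, Or.inr ⟨h4, rfl⟩⟩)⟩
        rw [Ne, Fin.ext_iff]; simp
    obtain ⟨i', b', hne, hs⟩ := hex
    have n1 := h _ (adj_of_stp k p _ _ _ _ hs)
    have n2 := h _ (adj_of_stp k p i i b (b + 1) (by unfold Stp; omega))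
    have n3 := h _ (adj_of_stp k p i i b (b - 1) (by unfold Stp; omega))
    have d1 := int_ne k (b + 1) (b - 1) (by omega) (by omega) (by omega)
    have d2 : ∀ x y : ZMod (2 * (4 * k + 2)), (i', x) ≠ (i, y) := fun x y he => hne (congrArg Prod.fst he)
    have d3 : (i, ((b + 1 : ℤ) : ZMod (2 * (4 * k + 2)))) ≠ (i, ((b - 1 : ℤ) : ZMod (2 * (4 * k + 2)))) :=
      fun he => d1 (congrArg Prod.snd he)
    rcases n1 with n1 | n1 <;> rcases n2 with n2 | n2 <;> rcases n3 with n3 | n3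
    all_goals first
      | exact d3 (n2.trans n3.symm)
      | exact d2 _ _ (n1.trans n2.symm)
      | exact d2 _ _ (n1.trans n3.symm)
  · intro h
    refine ⟨(i, ((b + 1 : ℤ) : ZMod (2 * (4 * k + 2)))), (i, ((b - 1 : ℤ) : ZMod (2 * (4 * k + 2)))), ?_⟩
    rintro ⟨i', w⟩ hw
    obtain ⟨b', rfl, hs⟩ := stp_of_adj k p _ _ _ _ hw
    have hi' := i'.2
    have hii : i' = i := by
      unfold Stp at hs
      apply Fin.ext; omega
    have hb : b' = b + 1 ∨ b' = b - 1 := by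
      unfold Stp at hs; omega
    rcases hb with rfl | rfl <;> simp [hii]

theorem fix_last (k p : ℕ) (α : AT (4 * k + 2) p ≃g AT (4 * k + 2) p) (u w)
    (hu : α u = u) (hw : (AT (4 * k + 2) p).Adj u w)
    (h : ∀ w', (AT (4 * k + 2) p).Adj u w' → w' ≠ w → α w' = w' ∨ α w ≠ w') : α w = w := by
  by_contra hne
  have h1 : (AT (4 * k + 2) p).Adj u (α w) := by
    have := α.map_adj_iff.mpr hw
    rwa [hu] at this
  rcases h _ h1 hne with h2 | h2
  · exact hne (α.injective h2)
  · exact h2 rfl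

/-- lifted version -/
theorem fix_last' (k p : ℕ) (α : AT (4 * k + 2) p ≃g AT (4 * k + 2) p) (i j : Fin (p + 1)) (b c : ℤ)
    (hu : α (i, (b : ZMod (2 * (4 * k + 2)))) = (i, (b : ZMod (2 * (4 * k + 2)))))
    (hw : Stp (i : ℕ) b (j : ℕ) c)
    (h : ∀ (i' : Fin (p + 1)) (b' : ℤ), Stp (i : ℕ) b (i' : ℕ) b' → (i' ≠ j ∨ b' ≠ c) →
      α (i', (b' : ZMod (2 * (4 * k + 2)))) = (i', (b' : ZMod (2 * (4 * k + 2)))) ∨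
        α (j, (c : ZMod (2 * (4 * k + 2)))) ≠ (i', (b' : ZMod (2 * (4 * k + 2))))) :
    α (j, (c : ZMod (2 * (4 * k + 2)))) = (j, (c : ZMod (2 * (4 * k + 2)))) := by
  apply fix_last k p α _ _ hu (adj_of_stp k p _ _ _ _ hw)
  rintro ⟨i', x⟩ ha hne
  obtain ⟨b', rfl, hs⟩ := stp_of_adj k p _ _ _ _ ha
  apply h i' b' hs
  by_contra hcon
  push Not at hcon
  apply hne
  rw [hcon.1, hcon.2]

/-- adjacent to a boundary vertex -/
def NB (k p : ℕ) (u : Fin (p + 1) × ZMod (2 * (4 * k + 2))) : Prop :=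
  ∃ w, (AT (4 * k + 2) p).Adj u w ∧ Bd k p w

theorem NB_iso (k p : ℕ) (α : AT (4 * k + 2) p ≃g AT (4 * k + 2) p) (u) (h : NB k p u) :
    NB k p (α u) := by
  obtain ⟨w, h1, h2⟩ := h
  exact ⟨α w, α.map_adj_iff.mpr h1, Bd_iso k p α w h2⟩

theorem rigid0 (k p : ℕ) (hp : 4 ≤ p) (α : AT (4 * k + 2) p ≃g AT (4 * k + 2) p)
    (h0 : α (0, 0) = (0, 0)) (m : ℕ) :
    α (0, ((m : ℤ) : ZMod (2 * (4 * k + 2)))) = (0, ((m : ℤ) : ZMod (2 * (4 * k + 2)))) ∧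
    α (0, ((m + 1 : ℤ) : ZMod (2 * (4 * k + 2)))) = (0, ((m + 1 : ℤ) : ZMod (2 * (4 * k + 2)))) := by
  induction m with
  | zero =>
    have h0' : α (0, ((0 : ℤ) : ZMod (2 * (4 * k + 2)))) = (0, ((0 : ℤ) : ZMod (2 * (4 * k + 2)))) := by
      simpa using h0
    refine ⟨by simpa using h0, ?_⟩
    apply fix_last' k p α 0 0 0 _ h0' (by unfold Stp; simp)
    intro i' b' hs hne
    right
    intro he
    have hB : Bd k p (0, (((0 : ℕ) + 1 : ℤ) : ZMod (2 * (4 * k + 2)))) := by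
      rw [Bd_iff k p hp]; simp
    have := Bd_iso k p α _ hB
    rw [he, Bd_iff k p hp] at this
    have hz : ((0 : Fin (p + 1)) : ℕ) = 0 := rfl
    rw [hz] at hs
    unfold Stp at hs
    have : ¬ (i' = 0 ∧ b' = 1) := by
      rintro ⟨rfl, rfl⟩; simp at hne
    rw [Fin.ext_iff, hz] at this
    omega
  | succ m ih =>
    obtain ⟨ih1, ih2⟩ := ih
    have e1 : (((m + 1 : ℕ) : ℤ)) = (m : ℤ) + 1 := by push_cast; ring
    rw [e1]
    refine ⟨ih2, ?_⟩
    apply fix_last' k p α 0 0 (m + 1) (m + 1 + 1) ih2 (by unfold Stp; simp)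
    intro i' b' hs hne
    have hz : ((0 : Fin (p + 1)) : ℕ) = 0 := rfl
    rw [hz] at hs
    have hne' : ¬ ((i' : ℕ) = 0 ∧ b' = m + 1 + 1) := by
      rintro ⟨h1, rfl⟩
      rcases hne with hne | hne
      · exact hne (Fin.ext h1)
      · exact hne rfl
    have hcase : ((i' : ℕ) = 0 ∧ b' = m) ∨ ((i' : ℕ) = 1 ∧ (m : ℤ) % 4 = 1 ∧ b' = m) ∨
        ((i' : ℕ) = 1 ∧ (m : ℤ) % 4 = 2 ∧ b' = m + 1 + 1) := by
      unfold Stp at hs; omega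
    rcases hcase with ⟨h1, h2⟩ | ⟨h1, h2, h3⟩ | ⟨h1, h2, h3⟩
    · left
      have : i' = 0 := Fin.ext h1
      rw [this, h2]; exact ih1
    · right
      intro he
      have hN : NB k p (0, ((m + 1 + 1 : ℤ) : ZMod (2 * (4 * k + 2)))) := by
        refine ⟨(0, ((m + 1 + 1 + 1 : ℤ) : ZMod (2 * (4 * k + 2)))), ?_, ?_⟩
        · apply adj_of_stp; unfold Stp; simp
        · rw [Bd_iff k p hp, hz]; omega
      have := NB_iso k p α _ hN
      rw [he] at this
      obtain ⟨⟨j, x⟩, g1, g2⟩ := this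
      obtain ⟨c, rfl, hs'⟩ := stp_of_adj k p _ _ _ _ g1
      rw [Bd_iff k p hp] at g2
      rw [h1] at hs'
      unfold Stp at hs'
      omega
    · right
      intro he
      have hB : Bd k p (0, ((m + 1 + 1 : ℤ) : ZMod (2 * (4 * k + 2)))) := by
        rw [Bd_iff k p hp, hz]; omega
      have := Bd_iso k p α _ hB
      rw [he, Bd_iff k p hp] at this
      omega

theorem nat_lift (k : ℕ) (b : ℤ) : ∃ m : ℕ, (b : ZMod (2 * (4 * k + 2))) = ((m : ℤ) : ZMod (2 * (4 * k + 2))) := by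
  have : NeZero (2 * (4 * k + 2)) := ⟨by omega⟩
  exact ⟨(b : ZMod (2 * (4 * k + 2))).val, by simp⟩

theorem rigid (k p : ℕ) (hp : 4 ≤ p) (α : AT (4 * k + 2) p ≃g AT (4 * k + 2) p)
    (h0 : α (0, 0) = (0, 0)) (l : ℕ) : ∀ (i : Fin (p + 1)), (i : ℕ) = l → ∀ b : ℤ,
    α (i, (b : ZMod (2 * (4 * k + 2)))) = (i, (b : ZMod (2 * (4 * k + 2)))) := by
  induction l with
  | zero =>
    intro i hi b
    have : i = 0 := Fin.ext hi
    subst this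
    obtain ⟨m, hm⟩ := nat_lift k b
    rw [hm]
    exact (rigid0 k p hp α h0 m).1
  | succ l ih =>
    intro i hi b
    have hi2 := i.2
    set j : Fin (p + 1) := ⟨l, by omega⟩ with hj
    have hjl : (j : ℕ) = l := rfl
    have ihj := ih j hjl
    have g01 : ∀ b : ℤ, b % 4 < 2 →
        α (i, (b : ZMod (2 * (4 * k + 2)))) = (i, (b : ZMod (2 * (4 * k + 2)))) := by
      intro b hb
      have hc : b % 4 = 0 ∨ b % 4 = 1 := by omega
      rcases hc with hc | hc
      · apply fix_last' k p α j i (b - 1) b (ihj _) (by unfold Stp; omega)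
        intro i' b' hs hne
        left
        have hx : (i' : ℕ) = l := by
          rw [Ne, Fin.ext_iff] at hne
          unfold Stp at hs; omega
        exact ih i' hx b'
      · apply fix_last' k p α j i (b + 1) b (ihj _) (by unfold Stp; omega)
        intro i' b' hs hne
        left
        have hx : (i' : ℕ) = l := by
          rw [Ne, Fin.ext_iff] at hne
          unfold Stp at hs; omega
        exact ih i' hx b'
    have hc : b % 4 < 2 ∨ b % 4 = 2 ∨ b % 4 = 3 := by omega
    rcases hc with hc | hc | hc
    · exact g01 b hc
    · apply fix_last' k p α i i (b - 1) b (g01 _ (by omega)) (by unfold Stp; omega)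
      intro i' b' hs hne
      left
      have hx : (i' : ℕ) = l ∨ ((i' : ℕ) = i ∧ b' % 4 < 2) := by
        rw [Ne, Fin.ext_iff] at hne
        unfold Stp at hs; omega
      rcases hx with hx | ⟨hx, hx2⟩
      · exact ih i' hx b'
      · rw [Fin.ext hx]; exact g01 b' hx2
    · apply fix_last' k p α i i (b + 1) b (g01 _ (by omega)) (by unfold Stp; omega)
      intro i' b' hs hne
      left
      have hx : (i' : ℕ) = l ∨ ((i' : ℕ) = i ∧ b' % 4 < 2) := by
        rw [Ne, Fin.ext_iff] at hne
        unfold Stp at hs; omega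
      rcases hx with hx | ⟨hx, hx2⟩
      · exact ih i' hx b'
      · rw [Fin.ext hx]; exact g01 b' hx2

theorem aut_eq (k p : ℕ) (hp : 4 ≤ p) (α β : AT (4 * k + 2) p ≃g AT (4 * k + 2) p)
    (h : α (0, 0) = β (0, 0)) : α = β := by
  have h1 := rigid k p hp (α.trans β.symm) (by simp [h])
  ext1 ⟨i, x⟩
  obtain ⟨b, rfl⟩ := lift_ex k x
  have := h1 _ i rfl b
  have h2 := congrArg β this
  simpa using h2

/-- `phi` parametrised by `ZMod` -/
noncomputable def phiZ (k p : ℕ) (x : ZMod (2 * (4 * k + 2))) : AT (4 * k + 2) p ≃g AT (4 * k + 2) p :=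
  phi k p (x.val : ℤ)

theorem val_cast_self (k : ℕ) (x : ZMod (2 * (4 * k + 2))) :
    (((x.val : ℕ) : ℤ) : ZMod (2 * (4 * k + 2))) = x := by
  have : NeZero (2 * (4 * k + 2)) := ⟨by omega⟩
  simp

theorem phiZ_apply (k p : ℕ) (x) (i : Fin (p + 1)) : phiZ k p x (i, 0) =
    (if x.val % 4 < 2 then i else Fin.rev i, x) := by
  have hx := val_cast_self k x
  unfold phiZ
  rw [phi_apply]
  unfold phiF
  simp only [hx, add_zero, sub_zero, ite_self]
  congr 1
  have : ((x.val : ℤ) % 4 < 2) ↔ (x.val % 4 < 2) := by omega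
  simp only [this]

theorem phiZ_bij (k p : ℕ) (hp : 4 ≤ p) : Function.Bijective (phiZ k p) := by
  constructor
  · intro x y h
    have := congrArg (fun α => (α (0, 0)).2) h
    simpa [phiZ_apply] using this
  · intro α
    have hB : Bd k p (0, ((0 : ℤ) : ZMod (2 * (4 * k + 2)))) := by
      rw [Bd_iff k p hp]; simp
    have hB' := Bd_iso k p α _ hB
    rw [Int.cast_zero] at hB'
    refine ⟨(α (0, 0)).2, aut_eq k p hp _ _ ?_⟩
    rw [phiZ_apply]
    obtain ⟨⟨i, x⟩, hix⟩ : ∃ v, v = α (0, 0) := ⟨_, rfl⟩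
    rw [← hix] at hB' ⊢
    have hx := val_cast_self k x
    rw [← hx, Bd_iff k p hp] at hB'
    simp only
    rcases hB' with ⟨h1, h2⟩ | ⟨h1, h2⟩
    · have : x.val % 4 < 2 := by omega
      simp only [this, if_true]
      rw [show i = 0 from Fin.ext h1]
    · have : ¬ x.val % 4 < 2 := by omega
      simp only [this, if_false]
      have hi : Fin.rev (0 : Fin (p + 1)) = i := by
        apply Fin.ext; rw [Fin.val_rev]; simp [h1]
      rw [hi]

theorem sum_zmod (k : ℕ) [NeZero (2 * (4 * k + 2))] (f : ZMod (2 * (4 * k + 2)) → ℕ) :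
    ∑ x, f x = ∑ j ∈ Finset.range (8 * k + 4), f (((j : ℕ) : ℤ) : ZMod (2 * (4 * k + 2))) := by
  refine Finset.sum_nbij' (fun x => x.val) (fun j => (((j : ℕ) : ℤ) : ZMod (2 * (4 * k + 2))))
    ?_ ?_ ?_ ?_ ?_
  · intro x _
    have := ZMod.val_lt x
    simp only [Finset.mem_range]
    omega
  · intro j _; simp
  · intro x _; exact val_cast_self k x
  · intro j hj
    rw [Finset.mem_range] at hj
    simp only [Int.cast_natCast]
    exact ZMod.val_cast_of_lt (by omega)
  · intro x _
    rw [val_cast_self]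

theorem sum_four (f : ℕ → ℕ) (m : ℕ) : ∑ j ∈ Finset.range (4 * m), f j =
    ∑ s ∈ Finset.range m, (f (4 * s) + f (4 * s + 1) + f (4 * s + 2) + f (4 * s + 3)) := by
  induction m with
  | zero => simp
  | succ m ih =>
    rw [Finset.sum_range_succ, ← ih, show 4 * (m + 1) = 4 * m + 1 + 1 + 1 + 1 by ring,
      Finset.sum_range_succ, Finset.sum_range_succ, Finset.sum_range_succ, Finset.sum_range_succ]
    ring

theorem sum_blocks (k : ℕ) (g : ℤ → ℕ) (hg : ∀ b : ℤ, g (b - (8 * k + 4)) = g b) :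
    ∑ j ∈ Finset.range (8 * k + 4), g (j : ℤ) =
    ∑ m ∈ Finset.range k, (g (4 * m) + g (4 * m + 1) + g (4 * m + 2) + g (4 * m + 3) +
      (g (-4 * (m + 1)) + g (-4 * (m + 1) + 1) + g (-4 * (m + 1) + 2) + g (-4 * (m + 1) + 3))) +
    (g (4 * k) + g (4 * k + 1) + g (4 * k + 2) + g (4 * k + 3)) := by
  rw [show 8 * k + 4 = 4 * (k + 1 + k) by ring, sum_four, Finset.sum_range_add,
    Finset.sum_range_succ, add_right_comm]
  congr 1
  · rw [← Finset.sum_range_reflect (n := k) (f := fun x => g ((4 * (k + 1 + x) : ℕ) : ℤ) +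
      g ((4 * (k + 1 + x) + 1 : ℕ) : ℤ) + g ((4 * (k + 1 + x) + 2 : ℕ) : ℤ) +
      g ((4 * (k + 1 + x) + 3 : ℕ) : ℤ)), ← Finset.sum_add_distrib]
    apply Finset.sum_congr rfl
    intro m hm
    rw [Finset.mem_range] at hm
    have e : ∀ r : ℤ, g (-4 * (m + 1) + r) = g ((4 * (k + 1 + (k - 1 - m) : ℕ) : ℤ) + r) := by
      intro r
      rw [← hg ((4 * (k + 1 + (k - 1 - m) : ℕ) : ℤ) + r)]
      congr 1
      omega
    have e0 := e 0
    rw [add_zero, add_zero] at e0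
    rw [e0, e, e, e]
    push_cast
    rfl

theorem sum_refl (g : ℕ → ℕ) (q : ℕ) :
    ∑ i ∈ Finset.range (2 * q + 1), g ((4 * q - 4 * i + 1 : ℤ).natAbs) =
      ∑ l ∈ Finset.range (2 * q + 1), g (2 * l + 1) := by
  induction q with
  | zero => simp
  | succ q ih =>
    rw [show 2 * (q + 1) + 1 = 2 * q + 1 + 1 + 1 by ring, Finset.sum_range_succ,
      Finset.sum_range_succ',
      Finset.sum_range_succ (fun l => g (2 * l + 1)) (2 * q + 1 + 1),
      Finset.sum_range_succ (fun l => g (2 * l + 1)) (2 * q + 1), ← ih]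
    have e1 : (4 * ((q + 1 : ℕ) : ℤ) - 4 * ((0 : ℕ) : ℤ) + 1).natAbs = 2 * (2 * q + 1 + 1) + 1 := by
      omega
    have e2 : (4 * ((q + 1 : ℕ) : ℤ) - 4 * ((2 * q + 1 + 1 : ℕ) : ℤ) + 1).natAbs
        = 2 * (2 * q + 1) + 1 := by
      omega
    have e3 : ∀ i : ℕ, (4 * ((q + 1 : ℕ) : ℤ) - 4 * ((i + 1 : ℕ) : ℤ) + 1) = 4 * q - 4 * i + 1 := by
      intro i; push_cast; ring
    rw [e1, e2]
    simp only [e3]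
    ring

theorem sum_max (m p : ℕ) (h : m ≤ p) :
    ∑ l ∈ Finset.range (p + 1), max (2 * l + 1) (2 * m + 1) = (p + 1) ^ 2 + m * (m + 1) := by
  induction p, h using Nat.le_induction with
  | base =>
    rw [Finset.sum_congr rfl (g := fun _ => 2 * m + 1)]
    · simp; ring
    · intro l hl
      rw [Finset.mem_range] at hl
      omega
  | succ p hp ih =>
    rw [Finset.sum_range_succ, ih, max_eq_left (by omega)]
    ring

/-- the distance sum from one vertex -/
theorem S_rep (k p : ℕ) (i : Fin (p + 1)) [NeZero (2 * (4 * k + 2))] :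
    ∑ x : ZMod (2 * (4 * k + 2)), (AT (4 * k + 2) p).dist (i, 0) (phiZ k p x (i, 0)) =
      ∑ m ∈ Finset.range k, (24 * m + 12 + 4 * max ((2 * p - 4 * (i : ℕ) + 1 : ℤ).natAbs) (2 * m + 1)) +
        (12 * k + 2 + 2 * max ((2 * p - 4 * (i : ℕ) + 1 : ℤ).natAbs) (2 * k + 1)) := by
  have hi := i.2
  have r1 : ((Fin.rev i : Fin (p + 1)) : ℕ) = p - i := by rw [Fin.val_rev]; omega
  have hr : (((Fin.rev i : Fin (p + 1)) : ℕ) : ℤ) - (i : ℕ) = p - 2 * (i : ℕ) := by rw [r1]; omega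
  rw [sum_zmod]
  set g : ℤ → ℕ := fun b => (AT (4 * k + 2) p).dist (i, 0)
    (phiZ k p (b : ZMod (2 * (4 * k + 2))) (i, 0)) with hg
  have hper : ∀ b : ℤ, g (b - (8 * k + 4)) = g b := by
    intro b
    have : ((b - (8 * k + 4) : ℤ) : ZMod (2 * (4 * k + 2))) = (b : ZMod (2 * (4 * k + 2))) := by
      rw [int_eq_iff]; exact ⟨1, by ring⟩
    simp only [hg, this]
  have same : ∀ b : ℤ, b % 4 < 2 → (∀ M : ℤ, (M = 0 ∨ 2 * k + 1 ≤ M ∨ M ≤ - (2 * k + 1)) →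
      DD 0 b ≤ DD 0 (b + 4 * M)) → g b = DD 0 b := by
    intro b hb h
    have hv := val_mod4 k b
    have : ((b : ZMod (2 * (4 * k + 2)))).val % 4 < 2 := by omega
    simp only [hg, phiZ_apply, this, if_true]
    rw [dist_eq]
    · simp
    · simpa using h
  have opp : ∀ b : ℤ, 2 ≤ b % 4 → (∀ M : ℤ, (M = 0 ∨ 2 * k + 1 ≤ M ∨ M ≤ - (2 * k + 1)) →
      DD (p - 2 * (i : ℕ)) b ≤ DD (p - 2 * (i : ℕ)) (b + 4 * M)) → g b = DD (p - 2 * (i : ℕ)) b := by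
    intro b hb h
    have hv := val_mod4 k b
    have : ¬ ((b : ZMod (2 * (4 * k + 2)))).val % 4 < 2 := by omega
    simp only [hg, phiZ_apply, this, if_false]
    rw [dist_eq, hr]
    rw [hr]; exact h
  have hsum : ∑ j ∈ Finset.range (8 * k + 4), (AT (4 * k + 2) p).dist (i, 0)
      (phiZ k p (((j : ℕ) : ℤ) : ZMod (2 * (4 * k + 2))) (i, 0)) =
      ∑ j ∈ Finset.range (8 * k + 4), g (j : ℤ) := rfl
  rw [hsum, sum_blocks k g hper]
  clear hsum
  obtain ⟨a, ha⟩ : ∃ a : ℤ, a = p - 2 * (i : ℕ) := ⟨_, rfl⟩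
  have hA : (2 * p - 4 * (i : ℕ) + 1 : ℤ) = 2 * a + 1 := by rw [ha]; ring
  rw [hA]
  rw [← ha] at opp
  clear_value g
  clear hg
  -- values of the cover distance
  have D0 : ∀ s : ℤ, DD 0 (4 * s) = (4 * s).natAbs := by intro s; unfold DD; omega
  have D1 : ∀ s : ℤ, DD 0 (4 * s + 1) = (4 * s + 1).natAbs := by intro s; unfold DD; omega
  have D2 : ∀ s : ℤ, DD a (4 * s + 2) = (2 * s + 1).natAbs +
      max (2 * a + 1).natAbs (2 * s + 1).natAbs := by
    intro s; unfold DD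
    have e1 : (4*s+2+1)/2 = 2*s+1 := by omega
    have e2 : (4*s+2+2)/4 = s+1 := by omega
    have e3 : (4*s+2)/4 = s := by omega
    rw [e1, e2, e3]; omega
  have D3 : ∀ s : ℤ, DD a (4 * s + 3) = (2 * s + 2).natAbs +
      max (2 * a + 1).natAbs (2 * s + 1).natAbs := by
    intro s; unfold DD
    have e1 : (4*s+3+1)/2 = 2*s+2 := by omega
    have e2 : (4*s+3+2)/4 = s+1 := by omega
    have e3 : (4*s+3)/4 = s := by omega
    rw [e1, e2, e3]; omega
  have G0 : ∀ s : ℤ, -k ≤ s → s ≤ k → g (4 * s) = (4 * s).natAbs := by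
    intro s h1 h2
    rw [same _ (by omega), D0]
    intro M hM
    rw [show 4 * s + 4 * M = 4 * (s + M) by ring, D0, D0]
    omega
  have G1 : ∀ s : ℤ, -k ≤ s → s ≤ k → g (4 * s + 1) = (4 * s + 1).natAbs := by
    intro s h1 h2
    rw [same _ (by omega), D1]
    intro M hM
    rw [show 4 * s + 1 + 4 * M = 4 * (s + M) + 1 by ring, D1, D1]
    omega
  have G2 : ∀ s : ℤ, -k ≤ s → s ≤ k → g (4 * s + 2) = (2 * s + 1).natAbs +
      max (2 * a + 1).natAbs (2 * s + 1).natAbs := by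
    intro s h1 h2
    rw [opp _ (by omega), D2]
    intro M hM
    rw [show 4 * s + 2 + 4 * M = 4 * (s + M) + 2 by ring, D2, D2]
    have : (2 * s + 1).natAbs ≤ (2 * (s + M) + 1).natAbs := by omega
    gcongr
  have G3 : ∀ s : ℤ, -k - 1 ≤ s → s ≤ k - 1 → g (4 * s + 3) = (2 * s + 2).natAbs +
      max (2 * a + 1).natAbs (2 * s + 1).natAbs := by
    intro s h1 h2
    rw [opp _ (by omega), D3]
    intro M hM
    rw [show 4 * s + 3 + 4 * M = 4 * (s + M) + 3 by ring, D3, D3]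
    omega
  congr 1
  · apply Finset.sum_congr rfl
    intro m hm
    rw [Finset.mem_range] at hm
    have t : (-4 * ((m : ℤ) + 1)) = 4 * (-(m : ℤ) - 1) := by ring
    rw [t, G0, G0, G1, G1, G2, G2, G3, G3]
    all_goals try omega
  · have e : g (4 * k + 3) = g (4 * (-k - 1) + 3) := by
      rw [← hper]; congr 1; ring
    rw [e, G0, G1, G2, G3]
    all_goals try omega

theorem dist_iso_le {V : Type*} (G : SimpleGraph V) (β : G ≃g G) (u v : V) (h : G.Reachable u v) :
    G.dist (β u) (β v) ≤ G.dist u v := by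
  obtain ⟨w, hw⟩ := h.exists_walk_length_eq_dist
  rw [← hw, ← SimpleGraph.Walk.length_map β.toHom w]
  exact SimpleGraph.dist_le _

theorem dist_iso {V : Type*} (G : SimpleGraph V) (β : G ≃g G) (u v : V) :
    G.dist (β u) (β v) = G.dist u v := by
  by_cases h : G.Reachable u v
  · apply le_antisymm (dist_iso_le G β u v h)
    have h' : G.Reachable (β u) (β v) := h.map β.toHom
    simpa using dist_iso_le G β.symm _ _ h'
  · have h' : ¬ G.Reachable (β u) (β v) := by
      intro h'
      apply h
      simpa using h'.map β.symm.toHom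
    rw [SimpleGraph.dist_eq_zero_of_not_reachable h, SimpleGraph.dist_eq_zero_of_not_reachable h']

theorem S_inv (k p : ℕ) (hp : 4 ≤ p) [NeZero (2 * (4 * k + 2))]
    (β : AT (4 * k + 2) p ≃g AT (4 * k + 2) p) (u : Fin (p + 1) × ZMod (2 * (4 * k + 2))) :
    ∑ x, (AT (4 * k + 2) p).dist (β u) (phiZ k p x (β u)) =
      ∑ x, (AT (4 * k + 2) p).dist u (phiZ k p x u) := by
  classical
  let e : ZMod (2 * (4 * k + 2)) ≃ (AT (4 * k + 2) p ≃g AT (4 * k + 2) p) :=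
    Equiv.ofBijective _ (phiZ_bij k p hp)
  have he : ∀ x, e x = phiZ k p x := fun x => rfl
  let c : (AT (4 * k + 2) p ≃g AT (4 * k + 2) p) ≃ (AT (4 * k + 2) p ≃g AT (4 * k + 2) p) :=
    { toFun := fun α => (β.trans α).trans β.symm
      invFun := fun α => (β.symm.trans α).trans β
      left_inv := by intro α; ext1 u; simp
      right_inv := by intro α; ext1 u; simp }
  refine Fintype.sum_equiv ((e.trans c).trans e.symm) _ _ ?_
  intro x
  have h1 : phiZ k p (((e.trans c).trans e.symm) x) = c (phiZ k p x) := by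
    rw [← he, ← he]; simp
  rw [h1]
  have h2 : phiZ k p x (β u) = β (c (phiZ k p x) u) := by simp [c]
  rw [h2, dist_iso]

theorem S_total (k p : ℕ) (hp : 4 ≤ p) [NeZero (2 * (4 * k + 2))] :
    ∑ u : Fin (p + 1) × ZMod (2 * (4 * k + 2)), ∑ x, (AT (4 * k + 2) p).dist u (phiZ k p x u) =
      (8 * k + 4) * ∑ i : Fin (p + 1), ∑ x, (AT (4 * k + 2) p).dist (i, 0) (phiZ k p x (i, 0)) := by
  have hinv : Function.Involutive (fun u : Fin (p + 1) × ZMod (2 * (4 * k + 2)) =>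
      ((if u.2.val % 4 < 2 then u.1 else Fin.rev u.1, u.2) : Fin (p + 1) × ZMod (2 * (4 * k + 2)))) := by
    rintro ⟨i, x⟩
    by_cases h : x.val % 4 < 2 <;> simp [h]
  rw [← Equiv.sum_comp (Function.Involutive.toPerm _ hinv), Fintype.sum_prod_type, Finset.mul_sum]
  apply Finset.sum_congr rfl
  intro i _
  have : ∀ y : ZMod (2 * (4 * k + 2)), (Function.Involutive.toPerm _ hinv) (i, y) = phiZ k p y (i, 0) := by
    intro y; rw [phiZ_apply]; rfl
  simp only [this, S_inv k p hp]
  rw [Finset.sum_const, Finset.card_univ, ZMod.card, smul_eq_mul]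
  congr 1
  ring

theorem T_eval (k q : ℕ) (hk : k ≤ 2 * q) [NeZero (2 * (4 * k + 2))] :
    (3 * ((∑ i : Fin (2 * q + 1), ∑ x, (AT (4 * k + 2) (2 * q)).dist (i, 0) (phiZ k (2 * q) x (i, 0)) : ℕ) : ℚ) : ℚ) =
      3 * (2 * q + 1) * (12 * k ^ 2 + 12 * k + 2) + 3 * (4 * k + 2) * (2 * q + 1) ^ 2 +
        4 * k ^ 3 + 6 * k ^ 2 + 2 * k := by
  have h1 : ∀ m : ℕ, m ≤ 2 * q → ∑ i : Fin (2 * q + 1),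
      max ((2 * (2 * q : ℕ) - 4 * (i : ℕ) + 1 : ℤ).natAbs) (2 * m + 1) =
      (2 * q + 1) ^ 2 + m * (m + 1) := by
    intro m hm
    rw [← sum_max m (2 * q) hm, ← sum_refl (fun l => max l (2 * m + 1)) q, Finset.sum_range]
    apply Finset.sum_congr rfl
    intro i _
    congr 3
    push_cast; ring
  have h2 : ∑ i : Fin (2 * q + 1), ∑ x, (AT (4 * k + 2) (2 * q)).dist (i, 0) (phiZ k (2 * q) x (i, 0)) =
      ∑ m ∈ Finset.range k, ((2 * q + 1) * (24 * m + 12) + 4 * ((2 * q + 1) ^ 2 + m * (m + 1))) +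
      ((2 * q + 1) * (12 * k + 2) + 2 * ((2 * q + 1) ^ 2 + k * (k + 1))) := by
    simp only [S_rep]
    rw [Finset.sum_add_distrib, Finset.sum_comm]
    congr 1
    · apply Finset.sum_congr rfl
      intro m hm
      rw [Finset.mem_range] at hm
      rw [Finset.sum_add_distrib, ← Finset.mul_sum, h1 m (by omega)]
      simp
    · rw [Finset.sum_add_distrib, ← Finset.mul_sum, h1 k hk]
      simp
  have h3 : ∀ j : ℕ, (3 * ∑ m ∈ Finset.range j, ((2 * q + 1) * (24 * (m : ℚ) + 12) + 4 * ((2 * (q : ℚ) + 1) ^ 2 + m * (m + 1))) : ℚ)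
      = 3 * (2 * q + 1) * (12 * j ^ 2) + 12 * j * (2 * q + 1) ^ 2 + 4 * (j ^ 3 - j) := by
    intro j
    induction j with
    | zero => simp
    | succ j ih => rw [Finset.sum_range_succ, mul_add, ih]; push_cast; ring
  rw [h2]
  push_cast
  rw [mul_add, h3]
  ring

theorem stmt18 (n p : ℕ) (hp : 4 ≤ p) (hpe : Even p) (hn4 : n % 4 = 2) (hn : 14 ≤ n)
    (hle : n ≤ 4 * p) :
    GPindex (AT n p) =
      ((p : ℚ) + 1) * ((n : ℚ) ^ 4 / 48 + 3 * (n : ℚ) ^ 3 * (p : ℚ) / 4 +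
        3 * (n : ℚ) ^ 3 / 4 + (n : ℚ) ^ 2 * (p : ℚ) ^ 2 + 2 * (n : ℚ) ^ 2 * (p : ℚ) +
        11 * (n : ℚ) ^ 2 / 12 - (n : ℚ) * (p : ℚ) - (n : ℚ)) := by

  obtain ⟨k, rfl⟩ : ∃ k, n = 4 * k + 2 := ⟨n / 4, by omega⟩
  obtain ⟨q, rfl⟩ : ∃ q, p = 2 * q := by
    obtain ⟨r, hr⟩ := hpe
    exact ⟨r, by omega⟩
  have hNZ : NeZero (2 * (4 * k + 2)) := ⟨by omega⟩
  have hT := T_eval k q (by omega)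
  have hS := S_total k (2 * q) hp
  let e : ZMod (2 * (4 * k + 2)) ≃ (AT (4 * k + 2) (2 * q) ≃g AT (4 * k + 2) (2 * q)) :=
    Equiv.ofBijective _ (phiZ_bij k (2 * q) hp)
  have he : ∀ x, e x = phiZ k (2 * q) x := fun x => rfl
  have hcardA : Nat.card (AT (4 * k + 2) (2 * q) ≃g AT (4 * k + 2) (2 * q)) = 2 * (4 * k + 2) := by
    rw [← Nat.card_congr e, Nat.card_zmod]
  have hcardV : Nat.card (Fin (2 * q + 1) × ZMod (2 * (4 * k + 2))) = (2 * q + 1) * (2 * (4 * k + 2)) := by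
    rw [Nat.card_prod, Nat.card_zmod, Nat.card_eq_fintype_card, Fintype.card_fin]
  have hsum : (∑ᶠ u : Fin (2 * q + 1) × ZMod (2 * (4 * k + 2)),
      ∑ᶠ α : AT (4 * k + 2) (2 * q) ≃g AT (4 * k + 2) (2 * q),
        ((AT (4 * k + 2) (2 * q)).dist u (α u) : ℚ)) =
      ((∑ u : Fin (2 * q + 1) × ZMod (2 * (4 * k + 2)), ∑ x,
        (AT (4 * k + 2) (2 * q)).dist u (phiZ k (2 * q) x u) : ℕ) : ℚ) := by
    rw [finsum_eq_sum_of_fintype]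
    push_cast
    apply Finset.sum_congr rfl
    intro u _
    rw [← finsum_comp_equiv e, finsum_eq_sum_of_fintype]
    rfl
  unfold GPindex
  rw [hsum, hS, hcardA, hcardV]
  push_cast at hT ⊢
  have hne : (2 * (2 * (4 * (k : ℚ) + 2))) ≠ 0 := by positivity
  set T : ℚ := ∑ i : Fin (2 * q + 1), ∑ x : ZMod (2 * (4 * k + 2)),
    ((AT (4 * k + 2) (2 * q)).dist (i, 0) (phiZ k (2 * q) x (i, 0)) : ℚ) with hTdef
  have hT' : T = (3 * (2 * q + 1) * (12 * k ^ 2 + 12 * k + 2) + 3 * (4 * k + 2) * (2 * q + 1) ^ 2 +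
        4 * k ^ 3 + 6 * k ^ 2 + 2 * k) / 3 := by linarith
  rw [hT', div_mul_eq_mul_div, div_eq_iff hne]
  ring
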